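/- arXiv:1411.2058 — 3 statements merged into one kernel-verified Lean document; each statement's English description precedes it below -/
import Mathlib

section
/- Let G be a finite group, V a finite-dimensional complex vector space of dimension r ≥ 1, and ρ an irreducible representation of G on V with character χ(g) = tr ρ(g). Then r² · #{g ∈ G : χ(g) ≠ 0} ≥ #G; equivalently, the proportion of elements g ∈ G with χ(g) = 0 is at most 1 − 1/r². -/
/-- An endomorphism of finite order of a finite-dimensional complex vector space has trace of
norm at most the dimension. -/
theorem LinearMap.norm_trace_le_finrank_of_pow_eq_one {V : Type*} [AddCommGroup V] [Module ℂ V]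
    [FiniteDimensional ℂ V] {f : Module.End ℂ V} {n : ℕ} (hn : n ≠ 0) (hf : f ^ n = 1) :
    ‖LinearMap.trace ℂ V f‖ ≤ Module.finrank ℂ V := by
  rw [Module.End.trace_eq_sum_roots_charpoly_of_splits (IsAlgClosed.splits f.charpoly)]
  have norm_le_one : ∀ x ∈ f.charpoly.roots.map (‖·‖), x ≤ (1 : ℝ) := by
    intro x hx
    obtain ⟨μ, hμ, rfl⟩ := Multiset.mem_map.mp hx
    have hev : f.HasEigenvalue μ :=
      (Module.End.hasEigenvalue_iff_isRoot_charpoly f μ).mpr (Polynomial.isRoot_of_mem_roots hμ)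
    obtain ⟨v, hv⟩ := hev.exists_hasEigenvector
    have hpow : μ ^ n • v = (1 : ℂ) • v := by
      rw [← hv.pow_apply, hf, Module.End.one_apply, one_smul]
    exact (Complex.norm_eq_one_of_pow_eq_one (smul_left_injective ℂ hv.2 hpow) hn).le
  calc ‖f.charpoly.roots.sum‖
      ≤ (f.charpoly.roots.map (‖·‖)).sum := norm_multiset_sum_le _
    _ ≤ (f.charpoly.roots.map (‖·‖)).card • (1 : ℝ) := Multiset.sum_le_card_nsmul _ _ norm_le_one
    _ ≤ Module.finrank ℂ V := by
      rw [Multiset.card_map, nsmul_one, ← f.charpoly_natDegree]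
      exact_mod_cast f.charpoly.card_roots'

theorem Representation.norm_character_le_finrank {G V : Type*} [Group G] [Finite G]
    [AddCommGroup V] [Module ℂ V] [FiniteDimensional ℂ V] (ρ : Representation ℂ G V) (g : G) :
    ‖ρ.character g‖ ≤ Module.finrank ℂ V :=
  LinearMap.norm_trace_le_finrank_of_pow_eq_one Nat.card_pos.ne'
    (by rw [← map_pow, pow_card_eq_one', map_one])

theorem Representation.isIrreducible_of_forall_submodule {k G V : Type*} [Field k] [Monoid G]
    [AddCommGroup V] [Module k V] [Nontrivial V] (ρ : Representation k G V)
    (h : ∀ p : Submodule k V, (∀ g : G, ∀ v ∈ p, ρ g v ∈ p) → p = ⊥ ∨ p = ⊤) :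
    ρ.IsIrreducible where
  exists_pair_ne := ⟨⊥, ⊤, fun e => bot_ne_top (congrArg Subrepresentation.toSubmodule e)⟩
  eq_bot_or_eq_top p :=
    (h p.toSubmodule fun g _ hv => p.apply_mem_toSubmodule g hv).imp
      (fun e => Subrepresentation.toSubmodule_injective e)
      (fun e => Subrepresentation.toSubmodule_injective e)

theorem Representation.sum_character_mul_character_inv {G V : Type*} [Group G] [Fintype G]
    [AddCommGroup V] [Module ℂ V] [FiniteDimensional ℂ V] (ρ : Representation ℂ G V)
    [ρ.IsIrreducible] :
    ∑ g : G, ρ.character g * ρ.character g⁻¹ = Nat.card G := by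
  have hcard : (Nat.card G : ℂ) ≠ 0 := Nat.cast_ne_zero.mpr Nat.card_pos.ne'
  let _ : Invertible (Nat.card G : ℂ) := invertibleOfNonzero hcard
  have horth := Representation.char_orthonormal ρ ρ
  rwa [if_pos ⟨.refl ρ⟩, inv_mul_eq_one₀ hcard, eq_comm] at horth

theorem stmt_9 (G : Type*) [Group G] [Fintype G]
    (V : Type*) [AddCommGroup V] [Module ℂ V] [FiniteDimensional ℂ V]
    (ρ : Representation ℂ G V)
    (hr : 1 ≤ Module.finrank ℂ V)
    (hirr : ∀ p : Submodule ℂ V, (∀ g : G, ∀ v ∈ p, ρ g v ∈ p) → p = ⊥ ∨ p = ⊤) :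
    Nat.card G ≤
      (Module.finrank ℂ V) ^ 2 *
        Nat.card {g : G // LinearMap.trace ℂ V (ρ g) ≠ 0} := by
  classical
  have : Nontrivial V := Module.nontrivial_of_finrank_pos (R := ℂ) hr
  have := ρ.isIrreducible_of_forall_submodule hirr
  have term_le (g : G) : ‖ρ.character g * ρ.character g⁻¹‖ ≤
      if ρ.character g ≠ 0 then (Module.finrank ℂ V : ℝ) ^ 2 else 0 := by
    split_ifs with hg
    · rw [norm_mul, sq]
      gcongr <;> exact ρ.norm_character_le_finrank _
    · simp [not_not.mp hg]
  have key : (Nat.card G : ℝ) ≤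
      (Module.finrank ℂ V : ℝ) ^ 2 * Nat.card {g : G // ρ.character g ≠ 0} :=
    calc (Nat.card G : ℝ)
        = ‖∑ g : G, ρ.character g * ρ.character g⁻¹‖ := by
          rw [ρ.sum_character_mul_character_inv, Complex.norm_natCast]
      _ ≤ ∑ g : G, if ρ.character g ≠ 0 then (Module.finrank ℂ V : ℝ) ^ 2 else 0 :=
          norm_sum_le_of_le _ fun g _ => term_le g
      _ = (Module.finrank ℂ V : ℝ) ^ 2 * Nat.card {g : G // ρ.character g ≠ 0} := by
          rw [← Finset.sum_filter, Finset.sum_const, nsmul_eq_mul, mul_comm,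
            Nat.card_eq_fintype_card, Fintype.card_subtype]
  exact_mod_cast key
end

section
/- Let G be a finite group, V a finite-dimensional complex vector space of dimension r ≥ 1, and ρ an irreducible representation of G on V with character χ(g) = tr ρ(g). Call g ∈ G scalar if ρ(g) = c·id_V for some c ∈ ℂ. If r² · #{g ∈ G : g is scalar} = #G, then χ(g) = 0 for every g ∈ G that is not scalar. -/
open Module in
/-- A complex endomorphism of finite order has a left inverse whose trace is the conjugate trace. -/
theorem LinearMap.trace_eq_conj_trace_of_pow_eq_one {V : Type*} [AddCommGroup V] [Module ℂ V]
    [FiniteDimensional ℂ V] {f g : End ℂ V} {n : ℕ} (hn : n ≠ 0) (hf : f ^ n = 1)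
    (hgf : g * f = 1) :
    LinearMap.trace ℂ V g = starRingEnd ℂ (LinearMap.trace ℂ V f) := by
  have hss : f.IsSemisimple := by
    refine End.isSemisimple_of_squarefree_aeval_eq_zero
      (p := (Polynomial.X ^ n - 1 : Polynomial ℂ)) ?_ (by simp [hf])
    exact (Polynomial.X_pow_sub_one_separable_iff.mpr (by exact_mod_cast hn)).squarefree
  have hint := DirectSum.isInternal_submodule_of_iSupIndep_of_iSup_eq_top
    f.eigenspaces_iSupIndep hss.iSup_eigenspace_eq_top
  have hfin : {μ | f.eigenspace μ ≠ ⊥}.Finite :=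
    WellFoundedGT.finite_ne_bot_of_iSupIndep f.eigenspaces_iSupIndep
  have hnorm (μ : ℂ) (hμ : f.eigenspace μ ≠ ⊥) : ‖μ‖ = 1 := by
    obtain ⟨v, hv⟩ := (show f.HasEigenvalue μ from hμ).exists_hasEigenvector
    refine Complex.norm_eq_one_of_pow_eq_one (n := n) ?_ hn
    have h := hv.pow_apply n
    rw [hf, End.one_apply] at h
    exact smul_left_injective ℂ hv.2 (by simpa using h.symm)
  have hfμ (μ : ℂ) (v : V) (hv : v ∈ f.eigenspace μ) : f v = μ • v :=
    End.mem_eigenspace_iff.mp hv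
  have hgμ (μ : ℂ) (v : V) (hv : v ∈ f.eigenspace μ) : g v = starRingEnd ℂ μ • v := by
    rcases eq_or_ne v 0 with rfl | hv0
    · simp
    have hμ : ‖μ‖ = 1 := hnorm μ fun h ↦ hv0 (by simpa [h] using hv)
    have hμ0 : μ ≠ 0 := by rintro rfl; simp at hμ
    rw [← RCLike.inv_eq_conj hμ, eq_inv_smul_iff₀ hμ0, ← map_smul, ← hfμ μ v hv,
      ← End.mul_apply, hgf, End.one_apply]
  have mapsf (μ : ℂ) : Set.MapsTo f (f.eigenspace μ) (f.eigenspace μ) := fun v hv ↦ by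
    rw [hfμ μ v hv]; exact Submodule.smul_mem _ _ hv
  have mapsg (μ : ℂ) : Set.MapsTo g (f.eigenspace μ) (f.eigenspace μ) := fun v hv ↦ by
    rw [hgμ μ v hv]; exact Submodule.smul_mem _ _ hv
  rw [LinearMap.trace_eq_sum_trace_restrict' hint hfin mapsf,
    LinearMap.trace_eq_sum_trace_restrict' hint hfin mapsg, map_sum]
  refine Finset.sum_congr rfl fun μ _ ↦ ?_
  have ef : f.restrict (mapsf μ) = μ • (1 : End ℂ (f.eigenspace μ)) := by
    ext v; exact hfμ μ v v.2
  have eg : g.restrict (mapsg μ) = starRingEnd ℂ μ • (1 : End ℂ (f.eigenspace μ)) := by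
    ext v; exact hgμ μ v v.2
  simp [ef, eg]

namespace Representation

variable {G V : Type*} [Group G] [AddCommGroup V] [Module ℂ V] (ρ : Representation ℂ G V)

theorem isIrreducible_of_forall_submodule_s10 [Nontrivial V]
    (hirr : ∀ p : Submodule ℂ V, (∀ g : G, ∀ v ∈ p, ρ g v ∈ p) → p = ⊥ ∨ p = ⊤) :
    IsIrreducible ρ where
  exists_pair_ne := ⟨⊥, ⊤, fun h ↦ bot_ne_top (α := Submodule ℂ V)
    (congrArg Subrepresentation.toSubmodule h)⟩
  eq_bot_or_eq_top p :=
    (hirr p.toSubmodule fun g _ hv ↦ p.apply_mem_toSubmodule g hv).imp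
      (fun h ↦ Subrepresentation.toSubmodule_injective h)
      (fun h ↦ Subrepresentation.toSubmodule_injective h)

variable [Fintype G]

theorem map_pow_card_eq_one (g : G) : ρ g ^ Fintype.card G = 1 := by
  rw [← map_pow, pow_card_eq_one, map_one]

variable [FiniteDimensional ℂ V]

theorem character_inv_eq_conj (g : G) : ρ.character g⁻¹ = starRingEnd ℂ (ρ.character g) :=
  LinearMap.trace_eq_conj_trace_of_pow_eq_one Fintype.card_ne_zero (ρ.map_pow_card_eq_one g)
    (by rw [← map_mul, inv_mul_cancel, map_one])

theorem sum_normSq_character [IsIrreducible ρ] :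
    ∑ g : G, Complex.normSq (ρ.character g) = Nat.card G := by
  have hG : (Nat.card G : ℂ) ≠ 0 := by exact_mod_cast Nat.card_pos.ne'
  let _ : Invertible (Nat.card G : ℂ) := invertibleOfNonzero hG
  have h := char_orthonormal ρ ρ
  rw [if_pos ⟨Equiv.refl ρ⟩, inv_mul_eq_one₀ hG] at h
  simp_rw [character_inv_eq_conj, Complex.mul_conj] at h
  exact_mod_cast h.symm

theorem normSq_character_of_eq_smul_one {g : G} {c : ℂ} (h : ρ g = c • (1 : Module.End ℂ V)) :
    Complex.normSq (ρ.character g) = (Module.finrank ℂ V : ℝ) ^ 2 := by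
  cases subsingleton_or_nontrivial V
  · simp [character, h, Module.finrank_zero_of_subsingleton]
  have hc : c ^ Fintype.card G = 1 := by
    have h1 := ρ.map_pow_card_eq_one g
    rw [h, smul_pow, one_pow] at h1
    exact smul_left_injective ℂ (one_ne_zero (α := Module.End ℂ V)) (by simpa using h1)
  have hc1 : ‖c‖ = 1 := Complex.norm_eq_one_of_pow_eq_one hc Fintype.card_ne_zero
  simp [character, h, Complex.normSq_eq_norm_sq, hc1]

end Representation

theorem stmt_10 (G : Type*) [Group G] [Fintype G]
    (V : Type*) [AddCommGroup V] [Module ℂ V] [FiniteDimensional ℂ V]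
    (ρ : Representation ℂ G V)
    (hr : 1 ≤ Module.finrank ℂ V)
    (hirr : ∀ p : Submodule ℂ V, (∀ g : G, ∀ v ∈ p, ρ g v ∈ p) → p = ⊥ ∨ p = ⊤)
    (hproj : (Module.finrank ℂ V) ^ 2 *
        Nat.card {g : G // ∃ c : ℂ, ρ g = c • (1 : Module.End ℂ V)} = Nat.card G) :
    ∀ g : G, ¬ (∃ c : ℂ, ρ g = c • (1 : Module.End ℂ V)) →
      LinearMap.trace ℂ V (ρ g) = 0 := by
  classical
  intro g hg
  have : Nontrivial V := Module.nontrivial_of_finrank_pos (R := ℂ) hr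
  have : ρ.IsIrreducible := ρ.isIrreducible_of_forall_submodule_s10 hirr
  have htotal := ρ.sum_normSq_character
  have hscalar : ∑ x : G with ∃ c : ℂ, ρ x = c • (1 : Module.End ℂ V),
      Complex.normSq (ρ.character x) = Nat.card G := by
    rw [Finset.sum_congr rfl fun x hx ↦
      ρ.normSq_character_of_eq_smul_one (Finset.mem_filter.mp hx).2.choose_spec,
      Finset.sum_const, nsmul_eq_mul, ← Fintype.card_subtype, ← Nat.card_eq_fintype_card, mul_comm]
    exact_mod_cast hproj
  rw [← Finset.sum_filter_add_sum_filter_not _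
    (fun x ↦ ∃ c : ℂ, ρ x = c • (1 : Module.End ℂ V)), hscalar, add_eq_left,
    Finset.sum_eq_zero_iff_of_nonneg fun _ _ ↦ Complex.normSq_nonneg _] at htotal
  exact Complex.normSq_eq_zero.mp (htotal g (Finset.mem_filter.mpr ⟨Finset.mem_univ g, hg⟩))
end

section
/- Let G be a finite group, V a finite-dimensional complex vector space of dimension r ≥ 1, and ρ an irreducible representation of G on V with character χ(g) = tr ρ(g). Call g ∈ G scalar if ρ(g) = c·id_V for some c ∈ ℂ. If r² · #{g ∈ G : g is scalar} = #G, then r² · #{g ∈ G : χ(g) = 0} = (r² − 1) · #G; that is, exactly a proportion 1 − 1/r² of the elements of G have vanishing character. -/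
open scoped ComplexOrder in
/-- The trace of a complex representation of a finite group at `g⁻¹` is the complex conjugate of
its trace at `g`. -/
theorem Representation.trace_inv_eq_star_trace {G V : Type*} [Group G] [Fintype G]
    [AddCommGroup V] [Module ℂ V] [FiniteDimensional ℂ V] (ρ : Representation ℂ G V) (g : G) :
    LinearMap.trace ℂ V (ρ g⁻¹) = star (LinearMap.trace ℂ V (ρ g)) := by
  classical
  let b := Module.finBasis ℂ V
  let M : G → Matrix _ _ ℂ := fun h => LinearMap.toMatrix b b (ρ h)
  have hmul (x y : G) : M (x * y) = M x * M y := by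
    simp only [M, map_mul, LinearMap.toMatrix_mul]
  have hone : M 1 = 1 := by
    simp only [M, map_one, LinearMap.toMatrix_one]
  let P := ∑ h, (M h).conjTranspose * M h
  have hP : P.PosDef := by
    have hsplit : P = 1 + ∑ h ∈ Finset.univ.erase 1, (M h).conjTranspose * M h := by
      simp only [P]
      rw [← Finset.add_sum_erase _ _ (Finset.mem_univ (1 : G))]
      simp [hone]
    rw [hsplit]
    exact Matrix.PosDef.one.add_posSemidef
      (Matrix.posSemidef_sum _ fun h _ => Matrix.posSemidef_conjTranspose_mul_self _)
  have hinv : (M g).conjTranspose * P * M g = P := by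
    simp only [P, Finset.mul_sum, Finset.sum_mul]
    rw [← Equiv.sum_comp (Equiv.mulRight g) (fun h => (M h).conjTranspose * M h)]
    refine Finset.sum_congr rfl fun h _ => ?_
    simp [hmul, Matrix.conjTranspose_mul, mul_assoc]
  have hcomm : (M g).conjTranspose * P = P * M g⁻¹ := by
    rw [← hinv, mul_assoc _ (M g), ← hmul, mul_inv_cancel, hone, mul_one, hinv]
  have hdet : IsUnit P.det := P.isUnit_iff_isUnit_det.mp hP.isUnit
  have htr : (M g⁻¹).trace = (M g).conjTranspose.trace := by
    calc (M g⁻¹).trace = (P⁻¹ * (P * M g⁻¹)).trace := by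
          rw [← mul_assoc, Matrix.nonsing_inv_mul _ hdet, one_mul]
      _ = (M g).conjTranspose.trace := by
          rw [← hcomm, Matrix.trace_mul_comm, mul_assoc, Matrix.mul_nonsing_inv _ hdet, mul_one]
  rw [LinearMap.trace_eq_matrix_trace ℂ b, LinearMap.trace_eq_matrix_trace ℂ b,
    ← Matrix.trace_conjTranspose]
  exact htr

/-- An irreducible complex character of a finite group has norm one. -/
theorem Representation.sum_normSq_trace_eq_card {G V : Type*} [Group G] [Fintype G]
    [AddCommGroup V] [Module ℂ V] [FiniteDimensional ℂ V] (ρ : Representation ℂ G V)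
    [ρ.IsIrreducible] :
    ∑ g, Complex.normSq (LinearMap.trace ℂ V (ρ g)) = Nat.card G := by
  have hcard : (Nat.card G : ℂ) ≠ 0 := by simp
  let := invertibleOfNonzero hcard
  have h := Representation.char_orthonormal ρ ρ
  rw [if_pos ⟨Representation.Equiv.refl ρ⟩, inv_mul_eq_iff_eq_mul₀ hcard, mul_one] at h
  apply Complex.ofReal_injective
  push_cast
  rw [← h]
  refine Finset.sum_congr rfl fun g _ => ?_
  rw [Representation.character, Representation.character, ρ.trace_inv_eq_star_trace]
  exact (Complex.mul_conj _).symm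

/-- The trace of a representation of a finite group at a scalar element has absolute value equal
to the dimension. -/
theorem Representation.normSq_trace_of_eq_smul_one {G V : Type*} [Group G] [Fintype G]
    [AddCommGroup V] [Module ℂ V] [FiniteDimensional ℂ V] [Nontrivial V]
    (ρ : Representation ℂ G V) {g : G} {c : ℂ} (hc : ρ g = c • (1 : Module.End ℂ V)) :
    Complex.normSq (LinearMap.trace ℂ V (ρ g)) = (Module.finrank ℂ V : ℝ) ^ 2 := by
  have hpow : c ^ Fintype.card G = 1 := by
    have h : ρ (g ^ Fintype.card G) = 1 := by rw [pow_card_eq_one, map_one]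
    rw [map_pow, hc, smul_pow, one_pow] at h
    exact smul_left_injective ℂ (one_ne_zero (α := Module.End ℂ V)) (by simpa using h)
  have hnorm : ‖c‖ = 1 := Complex.norm_eq_one_of_pow_eq_one hpow Fintype.card_ne_zero
  rw [hc, map_smul, LinearMap.trace_one, Complex.normSq_eq_norm_sq]
  simp [hnorm]

theorem stmt_11 (G : Type*) [Group G] [Fintype G]
    (V : Type*) [AddCommGroup V] [Module ℂ V] [FiniteDimensional ℂ V]
    (ρ : Representation ℂ G V)
    (hr : 1 ≤ Module.finrank ℂ V)
    (hirr : ∀ p : Submodule ℂ V, (∀ g : G, ∀ v ∈ p, ρ g v ∈ p) → p = ⊥ ∨ p = ⊤)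
    (hproj : (Module.finrank ℂ V) ^ 2 *
        Nat.card {g : G // ∃ c : ℂ, ρ g = c • (1 : Module.End ℂ V)} = Nat.card G) :
    (Module.finrank ℂ V) ^ 2 *
        Nat.card {g : G // LinearMap.trace ℂ V (ρ g) = 0} =
      ((Module.finrank ℂ V) ^ 2 - 1) * Nat.card G := by
  classical
  have : Nontrivial V := Module.nontrivial_of_finrank_pos (R := ℂ) hr
  have : ρ.IsIrreducible :=
    { exists_pair_ne := ⟨⊥, ⊤, fun h =>
        bot_ne_top (α := Submodule ℂ V) (congrArg Subrepresentation.toSubmodule h)⟩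
      eq_bot_or_eq_top := fun p =>
        (hirr p.toSubmodule fun g v hv => p.apply_mem_toSubmodule g hv).imp
          (fun h => Subrepresentation.toSubmodule_injective h)
          (fun h => Subrepresentation.toSubmodule_injective h) }
  let scalar : G → Prop := fun g => ∃ c : ℂ, ρ g = c • (1 : Module.End ℂ V)
  have hscalar (g : G) (hg : scalar g) :
      Complex.normSq (LinearMap.trace ℂ V (ρ g)) = (Module.finrank ℂ V : ℝ) ^ 2 :=
    hg.elim fun _ hc => ρ.normSq_trace_of_eq_smul_one hc
  have hsum := ρ.sum_normSq_trace_eq_card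
  rw [← Finset.sum_filter_add_sum_filter_not _ scalar,
    Finset.sum_congr rfl fun g hg => hscalar g (Finset.mem_filter.mp hg).2,
    Finset.sum_const, nsmul_eq_mul, ← hproj, Nat.card_eq_fintype_card, Fintype.card_subtype] at hsum
  push_cast at hsum
  have hrest : ∑ g with ¬ scalar g, Complex.normSq (LinearMap.trace ℂ V (ρ g)) = 0 := by
    linarith
  rw [Finset.sum_eq_zero_iff_of_nonneg fun _ _ => Complex.normSq_nonneg _] at hrest
  have hiff (g : G) : LinearMap.trace ℂ V (ρ g) = 0 ↔ ¬ scalar g := by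
    refine ⟨fun h hg => ?_, fun hg => Complex.normSq_eq_zero.mp (hrest g (by simpa using hg))⟩
    have hzero := hscalar g hg
    rw [h, map_zero] at hzero
    have : (0 : ℝ) < (Module.finrank ℂ V : ℝ) ^ 2 := by positivity
    linarith
  have hcard : Nat.card {g : G // LinearMap.trace ℂ V (ρ g) = 0} =
      Nat.card G - Nat.card {g : G // scalar g} := by
    simp_rw [hiff, Nat.card_eq_fintype_card]
    exact Fintype.card_subtype_compl scalar
  rw [hcard, Nat.mul_sub, hproj, Nat.sub_mul, one_mul]
end
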